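/- Let 0 < a_min ≤ a_j ≤ a_max for j = 1,...,m, and let v_a(x) be the minimizer of d ↦ max_j [⟨∇f_j(x), d⟩/a_j + ½‖d‖²] with value θ_a(x). Then θ_a(x) = −½‖v_a(x)‖² and max_j ⟨∇f_j(x), v_a(x)⟩ ≤ −(a_min/(4a_max²))‖v(x)‖², where v(x) is the steepest common descent direction. -/

import Mathlib

open RealInnerProductSpace

/-- If `φ` is positively homogeneous and `w` minimizes `φ + ½‖·‖²`, then `φ w = -‖w‖²`. -/
theorem eq_neg_norm_sq_of_forall_add_half_norm_sq_le {E : Type*} [NormedAddCommGroup E]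
    [NormedSpace ℝ E] {φ : E → ℝ} (hφ : ∀ t : ℝ, 0 ≤ t → ∀ d, φ (t • d) = t * φ d) {w : E}
    (hw : ∀ d, φ w + (1 / 2) * ‖w‖ ^ 2 ≤ φ d + (1 / 2) * ‖d‖ ^ 2) : φ w = -‖w‖ ^ 2 := by
  have key : ∀ s : ℝ, -1 ≤ s → 0 ≤ s * (φ w + ‖w‖ ^ 2) + s ^ 2 * ‖w‖ ^ 2 / 2 := by
    intro s hs
    have h := hw ((1 + s) • w)
    rw [hφ _ (by linarith), norm_smul, mul_pow, Real.norm_eq_abs, sq_abs] at h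
    linarith
  generalize hq : ‖w‖ ^ 2 = q at key ⊢
  have hq0 : 0 ≤ q := hq ▸ sq_nonneg _
  obtain ⟨e, he⟩ : ∃ e, e = φ w + q := ⟨_, rfl⟩
  rw [← he] at key
  suffices e = 0 by linarith
  by_contra hne
  have hepos : 0 < |e| := abs_pos.2 hne
  have hK : 0 < |e| + q := by linarith
  have h := key (-e / (|e| + q)) (by
    rw [le_div_iff₀ hK]
    linarith [le_abs_self e])
  have heq : -e / (|e| + q) * e + (-e / (|e| + q)) ^ 2 * q / 2
      = -(e ^ 2 * (|e| + q / 2)) / (|e| + q) ^ 2 := by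
    field_simp
    ring
  have hneg : -(e ^ 2 * (|e| + q / 2)) / (|e| + q) ^ 2 < 0 :=
    div_neg_of_neg_of_pos (neg_lt_zero.2 (by positivity)) (by positivity)
  linarith

/-- For the Barzilai–Borwein type direction `v_a(x)` with scalars `a_j ∈ [a_min, a_max]`:
`θ_a(x) = -½‖v_a(x)‖²` and `D(x, v_a(x)) ≤ -(a_min/(4 a_max²))‖v(x)‖²`. -/
theorem stmt_7 {n m : ℕ} [NeZero m]
    (f : Fin m → EuclideanSpace ℝ (Fin n) → ℝ)
    (g : Fin m → EuclideanSpace ℝ (Fin n))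
    (x : EuclideanSpace ℝ (Fin n))
    (hg : ∀ j, HasGradientAt (f j) (g j) x)
    (amin amax : ℝ) (hamin : 0 < amin) (haminmax : amin ≤ amax)
    (a : Fin m → ℝ) (ha : ∀ j, amin ≤ a j ∧ a j ≤ amax)
    (va : EuclideanSpace ℝ (Fin n))
    (hva : ∀ d : EuclideanSpace ℝ (Fin n),
      (⨆ j, ⟪g j, va⟫ / a j) + (1 / 2) * ‖va‖ ^ 2 ≤ (⨆ j, ⟪g j, d⟫ / a j) + (1 / 2) * ‖d‖ ^ 2)
    (v : EuclideanSpace ℝ (Fin n))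
    (hv : ∀ d : EuclideanSpace ℝ (Fin n),
      (⨆ j, ⟪g j, v⟫) + (1 / 2) * ‖v‖ ^ 2 ≤ (⨆ j, ⟪g j, d⟫) + (1 / 2) * ‖d‖ ^ 2) :
    (⨆ j, ⟪g j, va⟫ / a j) + (1 / 2) * ‖va‖ ^ 2 = -(1 / 2) * ‖va‖ ^ 2 ∧
    (⨆ j, ⟪g j, va⟫) ≤ -(amin / (4 * amax ^ 2)) * ‖v‖ ^ 2 := by
  have hDa : (⨆ j, ⟪g j, va⟫ / a j) = -‖va‖ ^ 2 :=
    eq_neg_norm_sq_of_forall_add_half_norm_sq_le (φ := fun d => ⨆ j, ⟪g j, d⟫ / a j)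
      (fun t ht d => by
        simp only [real_inner_smul_right, mul_div_assoc, Real.mul_iSup_of_nonneg ht]) hva
  have hD : (⨆ j, ⟪g j, v⟫) = -‖v‖ ^ 2 :=
    eq_neg_norm_sq_of_forall_add_half_norm_sq_le (φ := fun d => ⨆ j, ⟪g j, d⟫)
      (fun t ht d => by simp only [real_inner_smul_right, Real.mul_iSup_of_nonneg ht]) hv
  refine ⟨by rw [hDa]; ring, ?_⟩
  have hamax : 0 < amax := hamin.trans_le haminmax
  have hnorm : ‖v‖ ^ 2 / amax ^ 2 ≤ ‖va‖ ^ 2 := by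
    have h := hva (amax⁻¹ • v)
    have hle : (⨆ j, ⟪g j, amax⁻¹ • v⟫ / a j) ≤ -(‖v‖ ^ 2 / amax ^ 2) := by
      refine ciSup_le fun j => ?_
      have haj : 0 < a j := hamin.trans_le (ha j).1
      have hj : ⟪g j, v⟫ ≤ -‖v‖ ^ 2 :=
        hD ▸ le_ciSup (f := fun j => ⟪g j, v⟫) (Set.finite_range _).bddAbove j
      rw [real_inner_smul_right, div_le_iff₀ haj]
      calc amax⁻¹ * ⟪g j, v⟫ ≤ amax⁻¹ * -‖v‖ ^ 2 := by gcongr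
        _ = -(‖v‖ ^ 2 / amax ^ 2 * amax) := by field_simp
        _ ≤ -(‖v‖ ^ 2 / amax ^ 2 * a j) := by
          gcongr
          exact (ha j).2
        _ = -(‖v‖ ^ 2 / amax ^ 2) * a j := by ring
    have hsq : ‖amax⁻¹ • v‖ ^ 2 = ‖v‖ ^ 2 / amax ^ 2 := by
      rw [norm_smul, mul_pow, Real.norm_eq_abs, sq_abs]
      field_simp
    rw [hDa, hsq] at h
    linarith
  refine ciSup_le fun j => ?_
  have haj : 0 < a j := hamin.trans_le (ha j).1
  have hj : ⟪g j, va⟫ / a j ≤ -‖va‖ ^ 2 :=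
    hDa ▸ le_ciSup (f := fun j => ⟪g j, va⟫ / a j) (Set.finite_range _).bddAbove j
  rw [div_le_iff₀ haj] at hj
  calc ⟪g j, va⟫ ≤ -(‖va‖ ^ 2 * a j) := by linarith
    _ ≤ -(‖v‖ ^ 2 / amax ^ 2 * amin) := by
      gcongr
      exact (ha j).1
    _ ≤ -(‖v‖ ^ 2 / amax ^ 2 * amin / 4) :=
      neg_le_neg (div_le_self (by positivity) (by norm_num))
    _ = -(amin / (4 * amax ^ 2)) * ‖v‖ ^ 2 := by field_simp
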